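/- arXiv:1009.5609 — 4 statements merged into one kernel-verified Lean document; each statement's English description precedes it below -/
import Mathlib

section
/- Let p : C̃ ⥤ C be a covering morphism of groupoids, let ỹ be an object of C̃, let F be a connected groupoid, let x be an object of F, and let f : F ⥤ C be a functor with f(x) = p(ỹ). Then there exists a functor f̃ : F ⥤ C̃ with p ∘ f̃ = f and f̃(x) = ỹ if and only if the image f(F(x)) of the vertex group of F at x under f is contained in the image p(C̃(ỹ)) of the vertex group of C̃ at ỹ under p, as subgroups of the vertex group C(p(ỹ)). -/
open CategoryTheory

/-- The map induced by a functor `p` from the costar of `y` (all morphisms with target `y`)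
to the costar of `p.obj y`. -/
def costarMap {H G : Type*} [Groupoid H] [Groupoid G] (p : H ⥤ G) (y : H) :
    (Σ u : H, u ⟶ y) → Σ v : G, v ⟶ p.obj y :=
  fun z => ⟨p.obj z.1, p.map z.2⟩

/-- A morphism of groupoids is a covering morphism if it induces a bijection on all costars. -/
def IsCoveringMorphism {H G : Type*} [Groupoid H] [Groupoid G] (p : H ⥤ G) : Prop :=
  ∀ y : H, Function.Bijective (costarMap p y)

/-- A groupoid is connected if there is a morphism between any two of its objects. -/
def GroupoidConnected (F : Type*) [Groupoid F] : Prop :=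
  ∀ x y : F, Nonempty (x ⟶ y)

namespace IsCoveringMorphism

variable {H G : Type*} [Groupoid H] [Groupoid G] {p : H ⥤ G}

/-- Every morphism into `p.obj y` lifts to a morphism into `y`. -/
theorem exists_lift (hp : IsCoveringMorphism p) {y : H} {v : G} (g : v ⟶ p.obj y) :
    ∃ (u : H) (l : u ⟶ y) (h : p.obj u = v), p.map l = eqToHom h ≫ g := by
  obtain ⟨⟨u, l⟩, hl⟩ := (hp y).2 ⟨v, g⟩
  simp only [costarMap, Sigma.mk.injEq] at hl
  obtain ⟨rfl, hl⟩ := hl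
  exact ⟨u, l, rfl, by simpa using hl⟩

/-- Lifts of a morphism with a prescribed target are unique. -/
theorem sigma_ext (hp : IsCoveringMorphism p) {y u v : H} (a : u ⟶ y) (b : v ⟶ y)
    (h : p.obj u = p.obj v) (hab : p.map a = eqToHom h ≫ p.map b) :
    (⟨u, a⟩ : Σ w : H, w ⟶ y) = ⟨v, b⟩ := by
  apply (hp y).1
  simp only [costarMap, Sigma.mk.injEq]
  refine ⟨h, ?_⟩
  rw [hab]
  exact eqToHom_comp_heq _ _

theorem faithful (hp : IsCoveringMorphism p) : p.Faithful where
  map_injective {u v} a b hab := by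
    have := hp.sigma_ext a b rfl (by simpa using hab)
    simpa using this

/-- A functor lifts through a covering morphism as soon as objects and morphisms lift
compatibly. -/
theorem exists_functor_lift (hp : IsCoveringMorphism p) {F : Type*} [Groupoid F] (f : F ⥤ G)
    (obj : F → H) (h : ∀ z, p.obj (obj z) = f.obj z)
    (hmap : ∀ {z w : F} (m : z ⟶ w), ∃ m' : obj z ⟶ obj w,
      p.map m' = eqToHom (h z) ≫ f.map m ≫ eqToHom (h w).symm) :
    ∃ f' : F ⥤ H, f' ⋙ p = f ∧ f'.obj = obj := by
  have := hp.faithful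
  choose map hmap using @hmap
  refine ⟨{ obj := obj, map := map, map_id := ?_, map_comp := ?_ }, ?_, rfl⟩
  · intro z
    apply p.map_injective
    simp [hmap]
  · intro z w v a b
    apply p.map_injective
    simp [hmap]
  · exact CategoryTheory.Functor.ext h fun z w m => hmap m

end IsCoveringMorphism

/-- a morphism `f : F ⥤ C` from a connected groupoid lifts through a
covering morphism `p : C̃ ⥤ C` to a morphism `f̃` with `f̃ x = ỹ` if and only if the image of
the vertex group `f(F(x))` is contained in `p(C̃(ỹ))`, as subgroups of `C(p ỹ)`. -/
theorem lift_through_covering_iff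
    {C' C F : Type*} [Groupoid C'] [Groupoid C] [Groupoid F]
    (p : C' ⥤ C) (hp : IsCoveringMorphism p) (y' : C')
    (hF : GroupoidConnected F) (x : F) (f : F ⥤ C) (hfx : f.obj x = p.obj y') :
    (∃ f' : F ⥤ C', f' ⋙ p = f ∧ f'.obj x = y') ↔
      {g : p.obj y' ⟶ p.obj y' | ∃ a : x ⟶ x, eqToHom hfx.symm ≫ f.map a ≫ eqToHom hfx = g}
        ⊆ {g : p.obj y' ⟶ p.obj y' | ∃ b : y' ⟶ y', p.map b = g} := by
  constructor
  · rintro ⟨f', rfl, rfl⟩ g ⟨a, rfl⟩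
    exact ⟨f'.map a, by simp⟩
  · intro hsub
    have t (z : F) : z ⟶ x := (hF z x).some
    choose obj l h hl using fun z => hp.exists_lift (f.map (t z) ≫ eqToHom hfx)
    have key : ∀ {z : F} (a : z ⟶ x), ∃ l' : obj z ⟶ y',
        p.map l' = eqToHom (h z) ≫ f.map a ≫ eqToHom hfx := by
      intro z a
      obtain ⟨b, hb⟩ := hsub ⟨inv (t z) ≫ a, rfl⟩
      exact ⟨l z ≫ b, by simp [hl, hb]⟩
    obtain ⟨f', hf', hobj⟩ := hp.exists_functor_lift f obj h (by
      intro z w m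
      obtain ⟨l', hl'⟩ := key (m ≫ t w)
      exact ⟨l' ≫ inv (l w), by simp [hl, hl']⟩)
    refine ⟨f', hf', ?_⟩
    obtain ⟨l', hl'⟩ := key (𝟙 x)
    have := hp.sigma_ext l' (𝟙 y') ((h x).trans hfx) (by simp [hl'])
    rw [hobj]
    exact congrArg Sigma.fst this
end

section
/- Let p : C̃ ⥤ C be a covering morphism of groupoids and let F be a connected groupoid. If f̃₁, f̃₂ : F ⥤ C̃ are functors with p ∘ f̃₁ = p ∘ f̃₂ and f̃₁(x) = f̃₂(x) for some object x of F, then f̃₁ = f̃₂. In particular, a lift through a covering morphism of a functor from a connected groupoid is uniquely determined by its value at one object. -/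
open CategoryTheory

/-- A covering morphism is injective on arrows with a common target. -/
theorem IsCoveringMorphism.heq_of_map_heq
    {H G : Type*} [Groupoid H] [Groupoid G] {p : H ⥤ G} (hp : IsCoveringMorphism p)
    {u u' y y' : H} (g : u ⟶ y) (g' : u' ⟶ y') (hy : y = y')
    (hu : p.obj u = p.obj u') (hg : p.map g ≍ p.map g') :
    u = u' ∧ g ≍ g' := by
  subst hy
  have h : (⟨u, g⟩ : Σ w : H, w ⟶ y) = ⟨u', g'⟩ :=
    (hp y).injective (Sigma.ext hu hg)
  exact Sigma.mk.inj_iff.mp h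

/-- two lifts through a covering morphism of a functor defined on a connected
groupoid which agree at one object are equal. -/
theorem lift_through_covering_unique
    {C' C F : Type*} [Groupoid C'] [Groupoid C] [Groupoid F]
    (p : C' ⥤ C) (hp : IsCoveringMorphism p)
    (hF : GroupoidConnected F) (f₁ f₂ : F ⥤ C')
    (hcomp : f₁ ⋙ p = f₂ ⋙ p) (x : F) (hx : f₁.obj x = f₂.obj x) :
    f₁ = f₂ := by
  have lift_eq {u y : F} (g : u ⟶ y) (hy : f₁.obj y = f₂.obj y) :
      f₁.obj u = f₂.obj u ∧ f₁.map g ≍ f₂.map g :=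
    hp.heq_of_map_heq _ _ hy (Functor.congr_obj hcomp u) (by
      simpa only [Functor.comp_map] using
        (Functor.hcongr_hom hcomp g : (f₁ ⋙ p).map g ≍ (f₂ ⋙ p).map g))
  have obj_eq (y : F) : f₁.obj y = f₂.obj y := (lift_eq (hF y x).some hx).1
  exact Functor.hext obj_eq fun _ y g => (lift_eq g (obj_eq y)).2
end

section
/- Let p : C̃ ⥤ C be a covering morphism of groupoids and let F be a connected and simply connected groupoid. Then for every functor f : F ⥤ C, every object x of F, and every object ỹ of C̃ with p(ỹ) = f(x), there exists a unique functor f̃ : F ⥤ C̃ such that p ∘ f̃ = f and f̃(x) = ỹ. -/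
open CategoryTheory

/-- A groupoid is simply connected if it is connected and all its vertex groups are trivial. -/
def GroupoidSimplyConnected (F : Type*) [Groupoid F] : Prop :=
  GroupoidConnected F ∧ ∀ (x : F) (a : x ⟶ x), a = 𝟙 x

namespace IsCoveringMorphism

variable {C' C F : Type*} [Groupoid C'] [Groupoid C] [Groupoid F] {p : C' ⥤ C}

/-- Two morphisms with equal targets and equal images under a covering morphism are equal. -/
theorem hom_ext (hp : IsCoveringMorphism p) {u v y z : C'} {a : u ⟶ y} {b : v ⟶ z}
    (hyz : y = z) (huv : p.obj u = p.obj v) (hab : p.map a ≍ p.map b) :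
    u = v ∧ a ≍ b := by
  subst hyz
  have h : (⟨u, a⟩ : Σ w : C', w ⟶ y) = ⟨v, b⟩ := (hp y).1 (Sigma.ext huv hab)
  exact Sigma.mk.inj h

/-- Every morphism into `p.obj y` lifts to a morphism into `y`. -/
theorem exists_lift_s2 (hp : IsCoveringMorphism p) {v w : C} (y : C') (hy : p.obj y = w)
    (a : v ⟶ w) : ∃ (u : C') (b : u ⟶ y) (hu : p.obj u = v),
      p.map b = eqToHom hu ≫ a ≫ eqToHom hy.symm := by
  subst hy
  obtain ⟨⟨u, b⟩, h⟩ := (hp y).2 ⟨v, a⟩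
  obtain ⟨hu, hb⟩ := Sigma.mk.inj h
  dsimp only at hu hb
  subst hu
  exact ⟨u, b, rfl, by simpa using hb⟩

/-- Lifts of functors from a connected groupoid are determined by their value at one object. -/
theorem functor_ext (hp : IsCoveringMorphism p) (hF : GroupoidConnected F) {g h : F ⥤ C'}
    (hgh : g ⋙ p = h ⋙ p) {x : F} (hx : g.obj x = h.obj x) : g = h := by
  have lift_ext {z w : F} (a : z ⟶ w) (hw : g.obj w = h.obj w) :
      g.obj z = h.obj z ∧ g.map a ≍ h.map a :=
    hp.hom_ext hw (Functor.congr_obj hgh z) (Functor.hcongr_hom hgh a)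
  have hobj (z : F) : g.obj z = h.obj z := (lift_ext (hF z x).some hx).1
  exact Functor.hext hobj fun _ w a => (lift_ext a (hobj w)).2

/-- A functor from a simply connected groupoid lifts through a covering morphism. -/
theorem exists_functor_lift_s2 (hp : IsCoveringMorphism p) (hF : GroupoidSimplyConnected F)
    (f : F ⥤ C) (x : F) (y : C') (hy : p.obj y = f.obj x) :
    ∃ g : F ⥤ C', g ⋙ p = f ∧ g.obj x = y := by
  have t (z : F) : z ⟶ x := (hF.1 z x).some
  choose u l hu hl using fun z => hp.exists_lift_s2 y hy (f.map (t z))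
  have ht {z w : F} (a : z ⟶ w) : a = t z ≫ Groupoid.inv (t w) := by
    have h := hF.2 z (a ≫ t w ≫ Groupoid.inv (t z))
    calc a = (a ≫ t w ≫ Groupoid.inv (t z)) ≫ t z ≫ Groupoid.inv (t w) := by simp
      _ = t z ≫ Groupoid.inv (t w) := by rw [h, Category.id_comp]
  let g : F ⥤ C' :=
    { obj := u
      map := fun {z w} _ => l z ≫ Groupoid.inv (l w)
      map_id := fun _ => by simp
      map_comp := fun _ _ => by simp }
  refine ⟨g, CategoryTheory.Functor.ext hu fun z w a => ?_, ?_⟩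
  · change p.map (l z ≫ Groupoid.inv (l w)) = _
    rw [ht a]
    simp [Groupoid.inv_eq_inv, hl]
  · refine (hp.hom_ext (a := l x) (b := 𝟙 y) rfl ((hu x).trans hy.symm) ?_).1
    rw [hl, hF.2 x (t x)]
    simp [eqToHom_heq_id_cod]

end IsCoveringMorphism

/-- any morphism from a connected and simply connected groupoid lifts uniquely
through a covering morphism, once the value at one object is prescribed compatibly. -/
theorem lift_through_covering_simply_connected
    {C' C F : Type*} [Groupoid C'] [Groupoid C] [Groupoid F]
    (p : C' ⥤ C) (hp : IsCoveringMorphism p)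
    (hF : GroupoidSimplyConnected F) (f : F ⥤ C) (x : F) (y' : C')
    (hfx : p.obj y' = f.obj x) :
    ∃! f' : F ⥤ C', f' ⋙ p = f ∧ f'.obj x = y' := by
  obtain ⟨g, hg, hgx⟩ := hp.exists_functor_lift_s2 hF f x y' hfx
  exact ⟨g, ⟨hg, hgx⟩, fun h ⟨hh, hhx⟩ =>
    hp.functor_ext hF.1 (hh.trans hg.symm) (hhx.trans hgx.symm)⟩
end

section
/- Let p : H ⥤ G be a covering morphism of groupoids and let f : K ⥤ G be any functor between groupoids. Form the strict pullback groupoid K ×_G H, whose objects are pairs (k, h) of an object k of K and an object h of H with f(k) = p(h), and whose morphisms (k, h) → (k', h') are pairs (a, b) of morphisms a : k → k' in K and b : h → h' in H with f(a) = p(b). Then the projection functor K ×_G H ⥤ K, (k, h) ↦ k, is a covering morphism of groupoids. -/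
open CategoryTheory

variable {K H G : Type*} [Groupoid K] [Groupoid H] [Groupoid G]

/-- The strict pullback of two functors of groupoids: objects are pairs `(k, h)` with
`f.obj k = p.obj h`. -/
structure GpdPullback (f : K ⥤ G) (p : H ⥤ G) where
  k : K
  h : H
  eq : f.obj k = p.obj h

namespace GpdPullback

variable (f : K ⥤ G) (p : H ⥤ G)

/-- A morphism `(k, h) ⟶ (k', h')` in the strict pullback is a pair `(a, b)` of morphisms
with `f.map a = p.map b` (modulo the identifications given by the object equalities). -/
@[ext]
structure Hom (z w : GpdPullback f p) where
  a : z.k ⟶ w.k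
  b : z.h ⟶ w.h
  comm : f.map a = eqToHom z.eq ≫ p.map b ≫ eqToHom w.eq.symm

instance : CategoryStruct (GpdPullback f p) where
  Hom z w := Hom f p z w
  id z := ⟨𝟙 _, 𝟙 _, by simp⟩
  comp {z w v} m n := ⟨m.a ≫ n.a, m.b ≫ n.b, by
    rw [Functor.map_comp, Functor.map_comp, m.comm, n.comm]; simp⟩

variable {f p}

@[simp] theorem id_a (z : GpdPullback f p) : Hom.a (𝟙 z) = 𝟙 z.k := rfl
@[simp] theorem id_b (z : GpdPullback f p) : Hom.b (𝟙 z) = 𝟙 z.h := rfl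
@[simp] theorem comp_a {z w v : GpdPullback f p} (m : z ⟶ w) (n : w ⟶ v) :
    Hom.a (m ≫ n) = m.a ≫ n.a := rfl
@[simp] theorem comp_b {z w v : GpdPullback f p} (m : z ⟶ w) (n : w ⟶ v) :
    Hom.b (m ≫ n) = m.b ≫ n.b := rfl

variable (f p)

/-- The strict pullback of two functors of groupoids is a groupoid. -/
instance groupoid : Groupoid (GpdPullback f p) where
  id_comp m := by apply Hom.ext <;> simp
  comp_id m := by apply Hom.ext <;> simp
  assoc m n o := by apply Hom.ext <;> simp
  inv {z w} m := ⟨Groupoid.inv m.a, Groupoid.inv m.b, by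
    rw [Groupoid.inv_eq_inv, Groupoid.inv_eq_inv, f.map_inv, p.map_inv]
    symm
    apply IsIso.eq_inv_of_hom_inv_id
    rw [m.comm]; simp⟩
  inv_comp m := by apply Hom.ext <;> simp [Groupoid.inv_eq_inv]
  comp_inv m := by apply Hom.ext <;> simp [Groupoid.inv_eq_inv]

/-- The first projection from the strict pullback. -/
def proj : GpdPullback f p ⥤ K where
  obj z := z.k
  map m := m.a
  map_id _ := rfl
  map_comp _ _ := rfl

end GpdPullback

/-- Equality in a costar amounts to an equality of sources compatible with the arrows. -/
theorem costar_ext_iff {C : Type*} [Category C] {x : C} (s t : Σ u : C, u ⟶ x) :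
    s = t ↔ ∃ e : s.1 = t.1, t.2 = eqToHom e.symm ≫ s.2 := by
  constructor
  · rintro rfl
    exact ⟨rfl, by simp⟩
  · obtain ⟨u, m⟩ := s
    obtain ⟨v, n⟩ := t
    rintro ⟨e, h⟩
    dsimp only at e h
    subst e
    simp [h]

/-- In the strict pullback, the second component of a morphism `m` into `w` lifts the image of
its first component to the costar of `w.h`. -/
theorem GpdPullback.costarMap_hom_b {f : K ⥤ G} {p : H ⥤ G} {z w : GpdPullback f p}
    (m : Hom f p z w) :
    costarMap p w.h ⟨z.h, m.b⟩ = ⟨f.obj z.k, f.map m.a ≫ eqToHom w.eq⟩ :=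
  (costar_ext_iff _ _).2 ⟨z.eq.symm, by simp [costarMap, m.comm]⟩

/-- the pullback of a covering morphism of groupoids along any functor is a
covering morphism. -/
theorem isCoveringMorphism_pullback
    (p : H ⥤ G) (hp : IsCoveringMorphism p) (f : K ⥤ G) :
    IsCoveringMorphism (GpdPullback.proj f p) := by
  intro w
  constructor
  · rintro ⟨⟨k, h, e⟩, m⟩ ⟨⟨k', h', e'⟩, m'⟩ hm
    obtain ⟨a, b, c⟩ := m
    obtain ⟨a', b', c'⟩ := m'
    have ha : (⟨k, a⟩ : Σ u : K, u ⟶ w.k) = ⟨k', a'⟩ := hm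
    have hb : (⟨h, b⟩ : Σ u : H, u ⟶ w.h) = ⟨h', b'⟩ := by
      apply (hp w.h).1
      cases ha
      exact (GpdPullback.costarMap_hom_b (z := ⟨k, h, e⟩) ⟨a, b, c⟩).trans
        (GpdPullback.costarMap_hom_b (z := ⟨k, h', e'⟩) ⟨a, b', c'⟩).symm
    cases ha
    cases hb
    rfl
  · rintro ⟨v, a : v ⟶ w.k⟩
    obtain ⟨⟨h, b⟩, hb⟩ := (hp w.h).2 ⟨f.obj v, f.map a ≫ eqToHom w.eq⟩
    obtain ⟨e : p.obj h = f.obj v, he⟩ := (costar_ext_iff _ _).1 hb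
    change f.map a ≫ eqToHom w.eq = eqToHom e.symm ≫ p.map b at he
    have hab : f.map a = eqToHom e.symm ≫ p.map b ≫ eqToHom w.eq.symm := by
      rw [← Category.assoc, ← he]
      simp
    exact ⟨⟨⟨v, h, e.symm⟩, ⟨a, b, hab⟩⟩, rfl⟩
end
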